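/- Fix D ∈ [0,1/3] and δ ∈ (0,1/21], and let f : [0,1] → ℝ be a 1-Lipschitz function with f(0) = 0, f(x) ≥ Dx on [0,1], and T(f) > (1−2D)/3 − δ. Set t₁ = (1+D)/3 − δ·((1+D)/(1−2D) − (1−D)). Then: (1) x − 3δ(1−D) < f(x) ≤ x for all x ∈ [0, t₁]; (2) t₁ − 3δ(1−D) < f(x) for all x ∈ [t₁, 2t₁ − 6δ(1−D)]; and (3) 3t₁ − x − 3δ(1−D) < f(x) < 1 + D − x + 3δ(1−D)/(1−2D) for all x ∈ [2t₁, 1]. -/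

import Mathlib

open Set

/-- A good partition of `[0,a]`: a strictly decreasing sequence `a = a₀ > a₁ > … > 0`
tending to `0` with `a_{n-1}/a_n ≤ 2`. -/
def IsGoodPartition (a : ℝ) (u : ℕ → ℝ) : Prop :=
  u 0 = a ∧ (∀ n, 0 < u n) ∧ (∀ n, u (n + 1) < u n) ∧
    Filter.Tendsto u Filter.atTop (nhds 0) ∧ ∀ n, u n ≤ 2 * u (n + 1)

/-- A `τ`-good partition: a good partition with `a_{n-1}/a_n ≥ 1 + τ`. -/
def IsTauGoodPartition (τ a : ℝ) (u : ℕ → ℝ) : Prop :=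
  IsGoodPartition a u ∧ ∀ n, (1 + τ) * u (n + 1) ≤ u n

/-- The total drop of `f` according to the partition `(a_n)`:
`T(f,(a_n)) = Σ_{n≥1} (f(a_n) − min_{[a_n, a_{n-1}]} f)`. -/
noncomputable def totalDrop (f : ℝ → ℝ) (u : ℕ → ℝ) : ℝ :=
  ∑' n : ℕ, (f (u (n + 1)) - sInf (f '' Set.Icc (u (n + 1)) (u n)))

/-- `T(f)`: the infimum of the total drop over all good partitions of `[0,a]`. -/
noncomputable def drop (a : ℝ) (f : ℝ → ℝ) : ℝ :=
  sInf {t | ∃ u, IsGoodPartition a u ∧ t = totalDrop f u}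

/-- `T_τ(f)`: the infimum of the total drop over all `τ`-good partitions of `[0,a]`. -/
noncomputable def dropTau (τ a : ℝ) (f : ℝ → ℝ) : ℝ :=
  sInf {t | ∃ u, IsTauGoodPartition τ a u ∧ t = totalDrop f u}

/-! ### Good partitions and the total drop -/

section Drop

variable {f : ℝ → ℝ} {a c : ℝ} {u : ℕ → ℝ}

lemma LipschitzOnWith.sub_le_of_le (hf : LipschitzOnWith 1 f (Icc 0 1)) {x y : ℝ} (hx : 0 ≤ x)
    (hxy : x ≤ y) (hy : y ≤ 1) : f x - f y ≤ y - x ∧ f y - f x ≤ y - x := by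
  have h := hf.dist_le_mul x ⟨hx, hxy.trans hy⟩ y ⟨hx.trans hxy, hy⟩
  rw [Real.dist_eq, Real.dist_eq, abs_sub_comm x y, abs_of_nonneg (sub_nonneg.2 hxy)] at h
  simp only [NNReal.coe_one, one_mul] at h
  have h' := abs_le.1 h
  constructor <;> linarith

lemma IsGoodPartition.le_start (hu : IsGoodPartition a u) (n : ℕ) : u n ≤ a := by
  induction n with
  | zero => exact hu.1.le
  | succ n ih => exact (hu.2.2.1 n).le.trans ih

lemma IsGoodPartition.drop_term_nonneg (hf : LipschitzOnWith 1 f (Icc 0 1)) (ha : a ≤ 1)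
    (hu : IsGoodPartition a u) (n : ℕ) :
    0 ≤ f (u (n + 1)) - sInf (f '' Icc (u (n + 1)) (u n)) := by
  have hle := (hu.2.2.1 n).le
  have hlow : BddBelow (f '' Icc (u (n + 1)) (u n)) := by
    refine ⟨f (u (n + 1)) - (u n - u (n + 1)), ?_⟩
    rintro _ ⟨y, hy, rfl⟩
    have := (hf.sub_le_of_le (hu.2.1 _).le hy.1 (hy.2.trans ((hu.le_start n).trans ha))).1
    linarith [hy.2]
  exact sub_nonneg.2 (csInf_le hlow ⟨_, left_mem_Icc.2 hle, rfl⟩)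

lemma IsGoodPartition.drop_term_le (hf : LipschitzOnWith 1 f (Icc 0 1)) (ha : a ≤ 1)
    (hu : IsGoodPartition a u) (n : ℕ) :
    f (u (n + 1)) - sInf (f '' Icc (u (n + 1)) (u n)) ≤ u n - u (n + 1) := by
  have hle := (hu.2.2.1 n).le
  have : f (u (n + 1)) - (u n - u (n + 1)) ≤ sInf (f '' Icc (u (n + 1)) (u n)) := by
    refine le_csInf ⟨_, _, left_mem_Icc.2 hle, rfl⟩ ?_
    rintro _ ⟨y, hy, rfl⟩
    have := (hf.sub_le_of_le (hu.2.1 _).le hy.1 (hy.2.trans ((hu.le_start n).trans ha))).1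
    linarith [hy.2]
  linarith

lemma IsGoodPartition.sum_drop_le (hf : LipschitzOnWith 1 f (Icc 0 1)) (ha : a ≤ 1)
    (hu : IsGoodPartition a u) (n : ℕ) :
    ∑ i ∈ Finset.range n, (f (u (i + 1)) - sInf (f '' Icc (u (i + 1)) (u i))) ≤ a := by
  refine (Finset.sum_le_sum fun i _ => hu.drop_term_le hf ha i).trans ?_
  rw [Finset.sum_range_sub', hu.1]
  linarith [hu.2.1 n]

lemma IsGoodPartition.summable_drop (hf : LipschitzOnWith 1 f (Icc 0 1)) (ha : a ≤ 1)
    (hu : IsGoodPartition a u) :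
    Summable fun n => f (u (n + 1)) - sInf (f '' Icc (u (n + 1)) (u n)) :=
  summable_of_sum_range_le (hu.drop_term_nonneg hf ha) (hu.sum_drop_le hf ha)

lemma drop_le_totalDrop (hf : LipschitzOnWith 1 f (Icc 0 1)) (ha : a ≤ 1)
    (hu : IsGoodPartition a u) : drop a f ≤ totalDrop f u := by
  refine csInf_le ⟨0, ?_⟩ ⟨u, hu, rfl⟩
  rintro _ ⟨v, hv, rfl⟩
  exact tsum_nonneg (hv.drop_term_nonneg hf ha)

lemma isGoodPartition_halving (ha : 0 < a) : IsGoodPartition a fun n => a * (1 / 2) ^ n := by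
  refine ⟨by simp, fun n => by positivity, fun n => ?_, ?_, fun n => ?_⟩
  · have : 0 < a * (1 / 2) ^ n := by positivity
    simp only [pow_succ]
    linarith
  · simpa using (tendsto_pow_atTop_nhds_zero_of_lt_one (r := (1 / 2 : ℝ)) (by norm_num)
      (by norm_num)).const_mul a
  · simp only [pow_succ]
    linarith

lemma drop_zero (f : ℝ → ℝ) : drop 0 f = 0 := by
  have : {t | ∃ u, IsGoodPartition 0 u ∧ t = totalDrop f u} = ∅ := by
    ext t
    simp only [mem_ofPred_eq, mem_empty_iff_false, iff_false]
    rintro ⟨u, hu, -⟩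
    exact (hu.2.1 0).ne' hu.1
  rw [drop, this, Real.sInf_empty]

lemma drop_le_self (hf : LipschitzOnWith 1 f (Icc 0 1)) (ha0 : 0 ≤ a) (ha : a ≤ 1) :
    drop a f ≤ a := by
  rcases ha0.eq_or_lt with rfl | ha0
  · exact (drop_zero f).le
  have hu := isGoodPartition_halving ha0
  exact (drop_le_totalDrop hf ha hu).trans
    (Real.tsum_le_of_sum_range_le (hu.drop_term_nonneg hf ha) (hu.sum_drop_le hf ha))

/-- Inserting one point `c` at the start of a good partition. -/
lemma drop_le_add_drop (hf : LipschitzOnWith 1 f (Icc 0 1)) (ha : a ≤ 1) (hc : 0 < c)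
    (hca : c ≤ a) (hac : a ≤ 2 * c) {m : ℝ} (hm : ∀ y ∈ Icc c a, m ≤ f y) :
    drop a f ≤ f c - m + drop c f := by
  rcases hca.eq_or_lt with rfl | hlt
  · linarith [hm c (left_mem_Icc.2 le_rfl)]
  suffices drop a f - (f c - m) ≤ drop c f by linarith
  refine le_csInf ⟨_, _, isGoodPartition_halving hc, rfl⟩ ?_
  rintro _ ⟨v, hv, rfl⟩
  let u : ℕ → ℝ := fun n => Nat.casesOn n a v
  have hu : IsGoodPartition a u := by
    refine ⟨rfl, ?_, ?_, (Filter.tendsto_add_atTop_iff_nat 1).1 hv.2.2.2.1, ?_⟩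
    · rintro (_ | n)
      · exact hc.trans hlt
      · exact hv.2.1 n
    · rintro (_ | n)
      · exact hv.1.trans_lt hlt
      · exact hv.2.2.1 n
    · rintro (_ | n)
      · change a ≤ 2 * v 0
        rwa [hv.1]
      · exact hv.2.2.2.2 n
  have hsplit : totalDrop f u = f (v 0) - sInf (f '' Icc (v 0) a) + totalDrop f v :=
    (hu.summable_drop hf ha).tsum_eq_zero_add
  have hinf : m ≤ sInf (f '' Icc c a) := by
    refine le_csInf ⟨_, _, left_mem_Icc.2 hca, rfl⟩ ?_
    rintro _ ⟨y, hy, rfl⟩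
    exact hm y hy
  have := drop_le_totalDrop hf ha hu
  rw [hsplit, hv.1] at this
  linarith

end Drop

/-! ### Stuck points -/

/-- The points `x` of `[0,1]` from which a partition cannot move on to a smaller value of `f`:
`f x` is the minimum of `f` on `[x/2, x]`. -/
def stuckPoints (f : ℝ → ℝ) : Set ℝ :=
  {x | x ∈ Icc (0 : ℝ) 1 ∧ ∀ y ∈ Icc (x / 2) x, f x ≤ f y}

section Stuck

variable {f : ℝ → ℝ} {a b s : ℝ}

lemma isClosed_stuckPoints (hf : LipschitzOnWith 1 f (Icc 0 1)) : IsClosed (stuckPoints f) := by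
  have heq : stuckPoints f =
      ⋂ θ ∈ Icc (1 / 2 : ℝ) 1, {x | x ∈ Icc (0 : ℝ) 1 ∧ f x ≤ f (θ * x)} := by
    ext x
    simp only [stuckPoints, mem_ofPred_eq, mem_iInter]
    constructor
    · rintro ⟨hx, h⟩ θ hθ
      exact ⟨hx, h _ ⟨by nlinarith [hθ.1, hx.1], by nlinarith [hθ.2, hx.1]⟩⟩
    · intro h
      have hx := (h 1 ⟨by norm_num, le_rfl⟩).1
      refine ⟨hx, fun y hy => ?_⟩
      rcases hx.1.eq_or_lt with rfl | hx0
      · rw [le_antisymm hy.2 (by linarith [hy.1])]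
      have := (h (y / x) ⟨by rw [le_div_iff₀ hx0]; linarith [hy.1],
        by rw [div_le_one hx0]; exact hy.2⟩).2
      rwa [div_mul_cancel₀ _ hx0.ne'] at this
  rw [heq]
  refine isClosed_biInter fun θ hθ => isClosed_Icc.isClosed_le hf.continuousOn ?_
  refine hf.continuousOn.comp (by fun_prop) fun x hx => ?_
  exact ⟨mul_nonneg (by linarith [hθ.1]) hx.1, by nlinarith [hθ.1, hθ.2, hx.1, hx.2]⟩

lemma zero_mem_stuckPoints (f : ℝ → ℝ) : (0 : ℝ) ∈ stuckPoints f :=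
  ⟨by simp, fun y hy => by rw [le_antisymm hy.2 (by linarith [hy.1])]⟩

lemma exists_last_stuckPoint (hf : LipschitzOnWith 1 f (Icc 0 1)) (ha : 0 ≤ a) :
    ∃ s ∈ stuckPoints f, s ≤ a ∧ ∀ x ∈ Ioc s a, x ∉ stuckPoints f := by
  obtain ⟨s, ⟨hsW, hs⟩, hmax⟩ :=
    (isCompact_Icc.inter_left (isClosed_stuckPoints hf)).exists_isGreatest
    (⟨0, zero_mem_stuckPoints f, le_rfl, ha⟩ : (stuckPoints f ∩ Icc 0 a).Nonempty)
  exact ⟨s, hsW, hs.2, fun x hx hxW => hx.1.not_ge (hmax ⟨hxW, hxW.1.1, hx.2⟩)⟩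

lemma exists_min_on_half (hf : LipschitzOnWith 1 f (Icc 0 1)) (ha0 : 0 < a) (ha : a ≤ 1) :
    ∃ x ∈ Icc (a / 2) a, ∀ y ∈ Icc (a / 2) a, f x ≤ f y :=
  isCompact_Icc.exists_isMinOn (nonempty_Icc.2 (by linarith))
    (hf.continuousOn.mono (Icc_subset_Icc (by linarith) ha))

/-- Moving on to a minimum point on `[a/2, a]` is free; if this skips a stuck point, then that
point may be used instead. -/
lemma drop_le_of_min (hf : LipschitzOnWith 1 f (Icc 0 1)) (ha : a ≤ 1)
    (hs : s ∈ stuckPoints f) (hsa : s < a) {x : ℝ} (hx : x ∈ Icc (a / 2) a)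
    (hmin : ∀ y ∈ Icc (a / 2) a, f x ≤ f y) :
    drop a f ≤ drop x f ∧ (x ≤ s → drop a f ≤ drop s f) := by
  have ha0 : 0 < a := hs.1.1.trans_lt hsa
  constructor
  · have := drop_le_add_drop (m := f x) hf ha (by linarith [hx.1]) hx.2 (by linarith [hx.1])
      fun y hy => hmin y ⟨hx.1.trans hy.1, hy.2⟩
    linarith
  · intro hxs
    have hfs : f s ≤ f x := hs.2 x ⟨by linarith [hx.1], hxs⟩
    have := drop_le_add_drop (m := f s) hf ha (by linarith [hx.1]) hsa.le (by linarith [hx.1])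
      fun y hy => hfs.trans (hmin y ⟨hx.1.trans (hxs.trans hy.1), hy.2⟩)
    linarith

lemma drop_le_or_exists_half (hf : LipschitzOnWith 1 f (Icc 0 1)) (ha : a ≤ 1)
    (hs : s ∈ stuckPoints f) (hsa : s < a) (hfree : ∀ x ∈ Ioc s a, x ∉ stuckPoints f) :
    drop a f ≤ drop s f ∨ ∃ x ∈ Ioc s (a / 2), drop a f ≤ drop x f := by
  have ha0 : 0 < a := hs.1.1.trans_lt hsa
  obtain ⟨x, hx, hxmin⟩ := exists_min_on_half hf ha0 ha
  obtain ⟨h1, h2⟩ := drop_le_of_min hf ha hs hsa hx hxmin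
  rcases le_or_gt x s with hxs | hxs
  · exact Or.inl (h2 hxs)
  have hx1 : x ≤ 1 := hx.2.trans ha
  have hx0 : 0 < x := hs.1.1.trans_lt hxs
  obtain ⟨z, hz, hzmin⟩ := exists_min_on_half hf hx0 hx1
  obtain ⟨h3, h4⟩ := drop_le_of_min hf hx1 hs hxs hz hzmin
  rcases le_or_gt z s with hzs | hzs
  · exact Or.inl (h1.trans (h4 hzs))
  refine Or.inr ⟨z, ⟨hzs, ?_⟩, h1.trans h3⟩
  by_contra! hlt
  refine hfree x ⟨hxs, hx.2⟩ ⟨⟨hx0.le, hx1⟩, fun y hy => ?_⟩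
  exact (hxmin z ⟨hlt.le, hz.2.trans hx.2⟩).trans (hzmin y hy)

/-- Descending to the last stuck point is free. -/
lemma drop_le_drop_stuckPoint (hf : LipschitzOnWith 1 f (Icc 0 1)) (ha : a ≤ 1)
    (hs : s ∈ stuckPoints f) (hsa : s ≤ a) (hfree : ∀ x ∈ Ioc s a, x ∉ stuckPoints f) :
    drop a f ≤ drop s f := by
  by_contra! hlt
  have hne : s ≠ a := by
    rintro rfl
    exact hlt.false
  have key : ∀ n : ℕ, ∃ x ∈ Ioc s (a * (1 / 2) ^ n), x ≤ a ∧ drop a f ≤ drop x f := by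
    intro n
    induction n with
    | zero => exact ⟨a, ⟨lt_of_le_of_ne hsa hne, by simp⟩, le_rfl, le_rfl⟩
    | succ n ih =>
      obtain ⟨x, hx, hxa, hax⟩ := ih
      rcases drop_le_or_exists_half hf (hxa.trans ha) hs hx.1
        (fun y hy => hfree y ⟨hy.1, hy.2.trans hxa⟩) with h | ⟨y, hy, hxy⟩
      · exact absurd (hax.trans h) hlt.not_ge
      · have hx0 : 0 < x := hs.1.1.trans_lt hx.1
        refine ⟨y, ⟨hy.1, ?_⟩, by linarith [hy.2], hax.trans hxy⟩
        rw [pow_succ]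
        linarith [hy.2, hx.2]
  have hlim : Filter.Tendsto (fun n : ℕ => a * (1 / 2 : ℝ) ^ n) Filter.atTop (nhds 0) := by
    simpa using (tendsto_pow_atTop_nhds_zero_of_lt_one (r := (1 / 2 : ℝ)) (by norm_num)
      (by norm_num)).const_mul a
  have hs0 : s ≤ 0 := ge_of_tendsto' hlim fun n => by
    obtain ⟨x, hx, -⟩ := key n
    exact (hx.1.trans_le hx.2).le
  obtain rfl : s = 0 := le_antisymm hs0 hs.1.1
  rw [drop_zero] at hlt
  refine hlt.not_ge (ge_of_tendsto' hlim fun n => ?_)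
  obtain ⟨x, hx, hxa, hax⟩ := key n
  exact hax.trans ((drop_le_self hf hx.1.le (hxa.trans ha)).trans hx.2)

/-- From a stuck point `b` one pays to climb to the first stuck point `c ∈ [b/2, b]`, and then
descends freely to the last stuck point `s ≤ b/2`. -/
lemma exists_climb_and_descend (hf : LipschitzOnWith 1 f (Icc 0 1)) (hb : b ∈ stuckPoints f)
    (hb0 : 0 < b) :
    ∃ c ∈ stuckPoints f, ∃ s ∈ stuckPoints f, b / 2 ≤ c ∧ c ≤ b ∧ s ≤ b / 2 ∧
      drop b f ≤ f c - f b + drop s f := by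
  obtain ⟨c, ⟨hcW, hc⟩, hmin⟩ :=
    (isCompact_Icc.inter_left (isClosed_stuckPoints hf)).exists_isLeast
      (⟨b, hb, by linarith, le_rfl⟩ : (stuckPoints f ∩ Icc (b / 2) b).Nonempty)
  obtain ⟨s, hsW, hsb, hfree⟩ := exists_last_stuckPoint hf (a := b / 2) (by linarith)
  refine ⟨c, hcW, s, hsW, hc.1, hc.2, hsb, ?_⟩
  rcases hc.1.eq_or_lt with hcb | hcb
  · have h1 := drop_le_add_drop (m := f b) hf hb.1.2 (by linarith) hc.2 (by linarith)
      fun y hy => hb.2 y ⟨hc.1.trans hy.1, hy.2⟩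
    have h2 := drop_le_drop_stuckPoint hf hcW.1.2 hsW (by linarith)
      fun x hx => hfree x ⟨hx.1, hx.2.trans hcb.ge⟩
    linarith
  refine le_of_forall_pos_le_add fun ε hε => ?_
  obtain ⟨x, hx, hxc⟩ : ∃ x, max (b / 2) (c - ε) < x ∧ x < c :=
    exists_between (max_lt hcb (by linarith))
  obtain ⟨hxb, hxε⟩ := max_lt_iff.1 hx
  have hx1 : x ≤ 1 := hxc.le.trans hcW.1.2
  have h1 := drop_le_add_drop (m := f b) hf hb.1.2 (by linarith) (hxc.le.trans hc.2) (by linarith)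
    fun y hy => hb.2 y ⟨hxb.le.trans hy.1, hy.2⟩
  have h2 := drop_le_drop_stuckPoint hf hx1 hsW (hsb.trans hxb.le) fun y hy hyW => by
    rcases le_or_gt y (b / 2) with h | h
    · exact hfree y ⟨hy.1, h⟩ hyW
    · exact (hy.2.trans_lt hxc).not_ge (hmin ⟨hyW, h.le, hy.2.trans (hxc.le.trans hc.2)⟩)
  have h3 := (hf.sub_le_of_le (by linarith) hxc.le hcW.1.2).1
  linarith

lemma stuckPoints_apply_le_half (hf : LipschitzOnWith 1 f (Icc 0 1)) (h0 : f 0 = 0)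
    (hb : b ∈ stuckPoints f) : f b ≤ b / 2 := by
  have h1 := hb.2 (b / 2) ⟨le_rfl, by linarith [hb.1.1]⟩
  have h2 := (hf.sub_le_of_le le_rfl (by linarith [hb.1.1] : 0 ≤ b / 2)
    (by linarith [hb.1.1, hb.1.2])).2
  linarith

/-- The bound on the climb `f c`, according to the position of `s`. -/
lemma climb_bound (hf : LipschitzOnWith 1 f (Icc 0 1)) (h0 : f 0 = 0) {c : ℝ}
    (hb : b ∈ stuckPoints f) (hc : c ∈ stuckPoints f) (hs : s ∈ stuckPoints f)
    (hcb : c ≤ b) (hbc : b / 2 ≤ c) (hsb : s ≤ b / 2) :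
    f c + (s - 2 * f s) / 3 ≤ b / 4 ∨ (f c ≤ c / 2 - (s - f s) ∧ f c ≤ b + f b - c) := by
  rcases le_or_gt s (c / 2) with hsc | hsc
  · right
    have h1 := hc.2 (c / 2) ⟨le_rfl, by linarith [hc.1.1]⟩
    have h2 := (hf.sub_le_of_le hs.1.1 hsc (by linarith [hc.1.1, hc.1.2])).2
    have h3 := (hf.sub_le_of_le hc.1.1 hcb hb.1.2).1
    constructor <;> linarith
  · left
    have h1 := hc.2 s ⟨hsc.le, hsb.trans hbc⟩
    have h2 := stuckPoints_apply_le_half hf h0 hs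
    linarith

lemma drop_stuckPoint_le (hf : LipschitzOnWith 1 f (Icc 0 1)) (h0 : f 0 = 0)
    (hb : b ∈ stuckPoints f) (hpos : ∀ x ∈ Icc (0 : ℝ) 1, 0 ≤ f x) :
    drop b f ≤ (b - 2 * f b) / 3 := by
  have key : ∀ n : ℕ, ∀ b ∈ stuckPoints f, drop b f ≤ (b - 2 * f b) / 3 + b * (1 / 2) ^ n := by
    intro n
    induction n with
    | zero =>
      intro b hb
      have h1 := drop_le_self hf hb.1.1 hb.1.2
      have h2 := stuckPoints_apply_le_half hf h0 hb
      rw [pow_zero]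
      linarith
    | succ n ih =>
      intro b hb
      rcases hb.1.1.eq_or_lt with rfl | hb0
      · simp [drop_zero, h0]
      obtain ⟨c, hc, s, hs, hbc, hcb, hsb, hdrop⟩ := exists_climb_and_descend hf hb hb0
      have h1 := ih s hs
      have h2 : s * (1 / 2) ^ n ≤ b / 2 * (1 / 2) ^ n := by gcongr
      rw [pow_succ]
      have h3 := hs.1.1
      have h4 := hpos b hb.1
      rcases climb_bound hf h0 hb hc hs hcb hbc hsb with h | ⟨h, h'⟩ <;> linarith
  have hlim : Filter.Tendsto (fun n : ℕ => (b - 2 * f b) / 3 + b * (1 / 2 : ℝ) ^ n)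
      Filter.atTop (nhds ((b - 2 * f b) / 3)) := by
    simpa using ((tendsto_pow_atTop_nhds_zero_of_lt_one (r := (1 / 2 : ℝ)) (by norm_num)
      (by norm_num)).const_mul b).const_add ((b - 2 * f b) / 3)
  exact ge_of_tendsto' hlim fun n => key n b hb

/-- Three stuck points `b`, `c`, `s` of a function with almost maximal drop. -/
lemma exists_stuckPoints_of_lt_drop (hf : LipschitzOnWith 1 f (Icc 0 1)) (h0 : f 0 = 0)
    {D δ : ℝ} (hD0 : 0 ≤ D) (hD3 : D ≤ 1 / 3) (hδ : δ ≤ 1 / 21)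
    (hbd : ∀ x ∈ Icc (0 : ℝ) 1, D * x ≤ f x) (hdrop : (1 - 2 * D) / 3 - δ < drop 1 f) :
    ∃ b ∈ stuckPoints f, ∃ c ∈ stuckPoints f, ∃ s ∈ stuckPoints f, c ≤ b ∧
      (1 - 2 * D) / 3 - δ < (b - 2 * f b) / 3 ∧
      (1 - 2 * D) / 3 - δ < f c - f b + (s - 2 * f s) / 3 ∧
      f c ≤ c / 2 - (s - f s) ∧ f c ≤ b + f b - c := by
  have hpos : ∀ x ∈ Icc (0 : ℝ) 1, 0 ≤ f x := fun x hx =>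
    (mul_nonneg hD0 hx.1).trans (hbd x hx)
  obtain ⟨b, hb, -, hfree⟩ := exists_last_stuckPoint hf (a := 1) zero_le_one
  have hTb := drop_le_drop_stuckPoint hf le_rfl hb hb.1.2 hfree
  have hTb' := drop_stuckPoint_le hf h0 hb hpos
  have hb0 : 0 < b := by
    refine lt_of_le_of_ne hb.1.1 ?_
    rintro rfl
    rw [drop_zero] at hTb
    linarith
  obtain ⟨c, hc, s, hs, hbc, hcb, hsb, hclimb⟩ := exists_climb_and_descend hf hb hb0
  have hTs := drop_stuckPoint_le hf h0 hs hpos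
  refine ⟨b, hb, c, hc, s, hs, hcb, by linarith, by linarith,
    (climb_bound hf h0 hb hc hs hcb hbc hsb).resolve_left fun h => ?_⟩
  have hDb := hbd b hb.1
  have hfb := hpos b hb.1
  nlinarith [hb.1.2]

end Stuck

/-- The inequalities between the constants of the stability theorem; `K` is `1 / (1 - 2 * D)`, and
`fb`, `fc`, `fs` are the values of `f` at its stuck points `b`, `c`, `s`. -/
lemma stability_constants {D δ K t b c s fb fc fs : ℝ} (hD0 : 0 ≤ D) (hD3 : D ≤ 1 / 3)
    (hδ0 : 0 < δ) (hδ1 : δ ≤ 1 / 21) (hK : K * (1 - 2 * D) = 1)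
    (ht : t = (1 + D) / 3 - δ * ((1 + D) * K - (1 - D)))
    (hb1 : b ≤ 1) (hs0 : 0 ≤ s) (hDb : D * b ≤ fb) (hDs : D * s ≤ fs) (hfs : fs ≤ s)
    (hb : (1 - 2 * D) / 3 - δ < (b - 2 * fb) / 3)
    (hfc : (1 - 2 * D) / 3 - δ < fc - fb + (s - 2 * fs) / 3)
    (hc1 : fc ≤ c / 2 - (s - fs)) (hc2 : fc ≤ b + fb - c) :
    0 ≤ t ∧ t ≤ 4 / 9 ∧ t ≤ c ∧ t - 3 * δ * (1 - D) < fc ∧ c / 2 - fc < 3 * δ * (1 - D) ∧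
      3 * t - 3 * δ * (1 - D) < fc + c ∧ 1 - b < 3 * δ * K ∧ 2 * (D * δ * K) = δ * K - δ := by
  have hK3 : K ≤ 3 := by nlinarith
  have hK1 : 1 ≤ K := by nlinarith
  have hbD : 0 ≤ (1 - b) * (1 - 2 * D) := mul_nonneg (by linarith) (by linarith)
  have hbgap : 1 - b < 3 * δ * K := by
    have h1 : (1 - b) * (1 - 2 * D) < 3 * δ := by linarith
    have h2 := mul_lt_mul_of_pos_right h1 (zero_lt_one.trans_le hK1)
    rwa [mul_assoc, mul_comm (1 - 2 * D), hK, mul_one] at h2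
  have hsgap : s < 3 * δ - (1 - b) * (1 - 2 * D) := by linarith
  have hsD : s * (1 - 2 * D) ≤ 3 * δ * (1 - 2 * D) :=
    mul_le_mul_of_nonneg_right (by linarith) (by linarith)
  have hDδ : D * (1 - b) ≤ D * (3 * δ * K) := mul_le_mul_of_nonneg_left hbgap.le hD0
  have hDK : 2 * (D * δ * K) = δ * K - δ := by linear_combination (-δ) * hK
  have hδK : δ * K ≤ 1 / 21 * 3 := mul_le_mul hδ1 hK3 (by linarith) (by norm_num)
  have hδK' : δ ≤ δ * K := le_mul_of_one_le_right hδ0.le hK1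
  have hDδK : D * (δ * K) ≤ D * (1 / 21 * 3) := mul_le_mul_of_nonneg_left hδK hD0
  have hDδ0 : 0 ≤ D * δ := mul_nonneg hD0 hδ0.le
  have hDδ1 : D * δ ≤ D * (δ * K) := mul_le_mul_of_nonneg_left hδK' hD0
  have hDδ3 : D * δ ≤ 1 / 3 * δ := mul_le_mul_of_nonneg_right hD3 hδ0.le
  have hfct : t - 3 * δ * (1 - D) < fc := by linarith
  refine ⟨by linarith, by linarith, ?_, hfct, by linarith, by linarith, hbgap, hDK⟩
  have h1 : (1 + D) * K ≤ 2 + 12 * D := by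
    have : 0 ≤ K * (1 + 7 * D - 24 * D ^ 2) := mul_nonneg (by linarith) (by nlinarith)
    linear_combination this + (2 + 12 * D) * hK
  have h2 : δ * ((1 + D) * K + 5 * (1 - D)) ≤ 1 / 21 * (7 * (1 + D)) :=
    mul_le_mul hδ1 (by linarith) (by nlinarith) (by norm_num)
  linarith

/-- **Proposition (stability).** Fix `D ∈ [0,1/3]`, `δ ∈ (0,1/21]` and let `f : [0,1] → ℝ`
be `1`-Lipschitz with `f(0) = 0`, `f(x) ≥ Dx` on `[0,1]` and `T(f) > (1−2D)/3 − δ`. Set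
`t₁ = (1+D)/3 − δ((1+D)/(1−2D) − (1−D))`. Then
(1) `x − 3δ(1−D) < f(x) ≤ x` on `[0, t₁]`;
(2) `t₁ − 3δ(1−D) < f(x)` on `[t₁, 2t₁ − 6δ(1−D)]`;
(3) `3t₁ − x − 3δ(1−D) < f(x) < 1 + D − x + 3δ(1−D)/(1−2D)` on `[2t₁, 1]`. -/
theorem statement17 (D δ : ℝ) (hD : D ∈ Set.Icc (0 : ℝ) (1 / 3))
    (hδ : δ ∈ Set.Ioc (0 : ℝ) (1 / 21))
    (f : ℝ → ℝ) (hf : LipschitzOnWith 1 f (Set.Icc 0 1)) (h0 : f 0 = 0)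
    (hbd : ∀ x ∈ Set.Icc (0 : ℝ) 1, D * x ≤ f x)
    (hdrop : (1 - 2 * D) / 3 - δ < drop 1 f)
    (t₁ : ℝ) (ht₁ : t₁ = (1 + D) / 3 - δ * ((1 + D) / (1 - 2 * D) - (1 - D))) :
    (∀ x ∈ Set.Icc (0 : ℝ) t₁, x - 3 * δ * (1 - D) < f x ∧ f x ≤ x) ∧
    (∀ x ∈ Set.Icc t₁ (2 * t₁ - 6 * δ * (1 - D)), t₁ - 3 * δ * (1 - D) < f x) ∧
    (∀ x ∈ Set.Icc (2 * t₁) 1,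
      3 * t₁ - x - 3 * δ * (1 - D) < f x ∧
      f x < 1 + D - x + 3 * δ * (1 - D) / (1 - 2 * D)) := by
  obtain ⟨b, hb, c, hc, s, hs, hcb, hTb, hTc, hc1, hc2⟩ :=
    exists_stuckPoints_of_lt_drop hf h0 hD.1 hD.2 hδ.2 hbd hdrop
  have hmono : ∀ x y, 0 ≤ x → x ≤ y → y ≤ 1 → x - f x ≤ y - f y := fun x y hx hxy hy => by
    linarith [(hf.sub_le_of_le hx hxy hy).2]
  have hfs : f s ≤ s := by linarith [hmono 0 s le_rfl hs.1.1 hs.1.2]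
  have hq : 1 - 2 * D ≠ 0 := by linarith [hD.2]
  rw [div_eq_mul_inv (1 + D) (1 - 2 * D)] at ht₁
  obtain ⟨ht0, ht_le, ht_c, hfc, hhalf, hsum, hbgap, hDK⟩ :=
    stability_constants hD.1 hD.2 hδ.1 hδ.2 (inv_mul_cancel₀ hq) ht₁ hb.1.2 hs.1.1
      (hbd b hb.1) (hbd s hs.1) hfs hTb hTc hc1 hc2
  have hlow : ∀ x, 0 ≤ x → x ≤ c / 2 → x - 3 * δ * (1 - D) < f x := fun x hx hxc => by
    have h1 := hc.2 (c / 2) ⟨le_rfl, by linarith⟩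
    linarith [hmono x (c / 2) hx hxc (by linarith [hc.1.1, hc.1.2])]
  refine ⟨fun x hx => ⟨?_, ?_⟩, fun x hx => ?_, fun x hx => ⟨?_, ?_⟩⟩
  · rcases le_or_gt x (c / 2) with h | h
    · exact hlow x hx.1 h
    · linarith [hx.2, hc.2 x ⟨h.le, hx.2.trans ht_c⟩]
  · linarith [hmono 0 x le_rfl hx.1 (by linarith [hx.2])]
  · rcases le_or_gt x (c / 2) with h | h
    · linarith [hlow x (ht0.trans hx.1) h, hx.1]
    · linarith [hc.2 x ⟨h.le, by linarith [hx.2]⟩]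
  · rcases le_or_gt x (c / 2) with h | h
    · linarith [hlow x (by linarith [hx.1]) h, hx.1]
    rcases le_or_gt x c with h' | h'
    · linarith [hc.2 x ⟨h.le, h'⟩, hx.1]
    · linarith [(hf.sub_le_of_le hc.1.1 h'.le hx.2).1]
  · rw [div_eq_mul_inv (3 * δ * (1 - D))]
    have hδ0 := hδ.1
    rcases le_or_gt x b with h | h
    · linarith [(hf.sub_le_of_le (by linarith [hx.1]) h hb.1.2).1, hb.1.2]
    · linarith [(hf.sub_le_of_le hb.1.1 h.le hx.2).2, hx.2]
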